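/- For any data of size n with pairwise distinct X-values and pairwise distinct Y-values and any M ∈ [n], the revised Chatterjee rank correlation satisfies the deterministic bounds ξ_{n,M} ≤ 1 - (3(M+1)/4)/(n + (M+1)/4) and ξ_{n,M} ≥ -1/2 + 3·[n - (n+1)(M+1)/4] / (2(n+1)(n + (M+1)/4)). -/

import Mathlib

open Finset

noncomputable section

/-- The rank of `Y_i` among `Y_1,…,Y_n`. -/
def rankOf {n : ℕ} (y : Fin n → ℝ) (i : Fin n) : ℕ :=
  (Finset.univ.filter fun j => y j ≤ y i).card

/-- The index of the `m`-th right nearest neighbor of `X_i` (the index `j` such that exactly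
`m` sample points `X_k` satisfy `X_i < X_k ≤ X_j`); equals `i` if no such index exists. -/
def rightNN {n : ℕ} (x : Fin n → ℝ) (m : ℕ) (i : Fin n) : Fin n :=
  if h : ∃ j, (Finset.univ.filter fun k => x i < x k ∧ x k ≤ x j).card = m then h.choose else i

/-- The revised Chatterjee rank correlation `ξ_{n,M}`. -/
def xiStat (n M : ℕ) (x y : Fin n → ℝ) : ℝ :=
  -2 + 6 * (∑ i, ∑ m ∈ Finset.Icc 1 M,
      (min (rankOf y i) (rankOf y (rightNN x m i)) : ℝ)) /
    ((n + 1) * (n * M + M * (M + 1) / 4))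

lemma rankOf_injective {n : ℕ} {y : Fin n → ℝ} (hy : Function.Injective y) :
    Function.Injective (rankOf y) := by
  have key : ∀ i j, y i < y j → rankOf y i < rankOf y j := by
    intro i j h
    refine card_lt_card ((ssubset_iff_of_subset ?_).2 ⟨j, by simp, by simpa using h⟩)
    intro k hk
    simp only [mem_filter, mem_univ, true_and] at hk ⊢
    exact hk.trans h.le
  intro i j h
  rcases lt_trichotomy (y i) (y j) with h' | h' | h'
  · exact absurd h (key i j h').ne
  · exact hy h'
  · exact absurd h (key j i h').ne'

lemma one_le_rankOf {n : ℕ} (y : Fin n → ℝ) (i : Fin n) : 1 ≤ rankOf y i :=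
  card_pos.2 ⟨i, by simp⟩

lemma rankOf_le {n : ℕ} (y : Fin n → ℝ) (i : Fin n) : rankOf y i ≤ n :=
  (card_le_univ _).trans_eq (Fintype.card_fin n)

lemma sum_rankOf {n : ℕ} {y : Fin n → ℝ} (hy : Function.Injective y) :
    2 * ∑ i, rankOf y i = n * (n + 1) := by
  have himage : univ.image (rankOf y) = Icc 1 n := by
    refine eq_of_subset_of_card_le ?_ ?_
    · intro r hr
      obtain ⟨i, -, rfl⟩ := mem_image.1 hr
      exact mem_Icc.2 ⟨one_le_rankOf y i, rankOf_le y i⟩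
    · rw [card_image_of_injective _ (rankOf_injective hy)]
      simp
  have hsum : ∑ i, rankOf y i = ∑ r ∈ range (n + 1), r := by
    rw [← sum_image (f := fun r => r) (rankOf_injective hy).injOn, himage,
      sum_range_succ', add_zero, range_eq_Ico, sum_Ico_add' (fun r => r) 0 n 1]
    rfl
  rw [hsum, mul_comm, sum_range_id_mul_two, Nat.add_sub_cancel, mul_comm]

/-- The sum of `n` distinct positive integers is at least `1 + ⋯ + n`. -/
lemma mul_succ_le_two_mul_sum_of_injective {n : ℕ} {f : Fin n → ℕ}
    (hf : Function.Injective f) (hpos : ∀ i, 1 ≤ f i) : n * (n + 1) ≤ 2 * ∑ i, f i := by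
  have hrank : ∀ i, rankOf (fun j => (f j : ℝ)) i ≤ f i := by
    intro i
    calc rankOf (fun j => (f j : ℝ)) i
        = ((univ.filter fun j => (f j : ℝ) ≤ f i).image f).card :=
          (card_image_of_injective _ hf).symm
      _ ≤ (Icc 1 (f i)).card := by
          refine card_le_card fun r hr => ?_
          obtain ⟨j, hj, rfl⟩ := mem_image.1 hr
          exact mem_Icc.2 ⟨hpos j, by simpa using hj⟩
      _ = f i := by simp
  rw [← sum_rankOf (Nat.cast_injective.comp hf : Function.Injective fun j => (f j : ℝ))]
  exact Nat.mul_le_mul_left 2 (sum_le_sum fun i _ => hrank i)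

lemma card_filter_rightNN {n : ℕ} (x : Fin n → ℝ) (m : ℕ) {i : Fin n}
    (hi : rightNN x m i ≠ i) :
    (univ.filter fun k => x i < x k ∧ x k ≤ x (rightNN x m i)).card = m := by
  by_cases h : ∃ j, (univ.filter fun k => x i < x k ∧ x k ≤ x j).card = m
  · rw [rightNN, dif_pos h]
    exact h.choose_spec
  · exact absurd (dif_neg h) hi

lemma rightNN_injOn {n : ℕ} {x : Fin n → ℝ} (hx : Function.Injective x) {m : ℕ} (hm : 1 ≤ m) :
    Set.InjOn (rightNN x m) {i | rightNN x m i ≠ i} := by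
  have key : ∀ i j, rightNN x m i ≠ i → rightNN x m j ≠ j →
      rightNN x m i = rightNN x m j → ¬ x i < x j := by
    intro i j hi hj h hlt
    have hc := card_filter_rightNN x m hi
    have hcj := card_filter_rightNN x m hj
    rw [h] at hc
    obtain ⟨k, hk⟩ := card_pos.1 (hcj ▸ hm)
    simp only [mem_filter, mem_univ, true_and] at hk
    refine (hcj.trans hc.symm).not_lt (card_lt_card
      ((ssubset_iff_of_subset ?_).2 ⟨j, by simpa using ⟨hlt, hk.1.le.trans hk.2⟩, by simp⟩))
    intro l hl
    simp only [mem_filter, mem_univ, true_and] at hl ⊢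
    exact ⟨hlt.trans hl.1, hl.2⟩
  intro i hi j hj h
  exact hx (le_antisymm (not_lt.1 (key j i hj hi h.symm)) (not_lt.1 (key i j hi hj h)))

/-- If `g` is injective off its fixed points, then each value of an injective `R` occurs at most
twice among the `min (R i) (R (g i))`, which bounds their sum from below. -/
lemma mul_add_two_le_four_mul_sum_min {n : ℕ} {R : Fin n → ℕ} (hR : Function.Injective R)
    (hpos : ∀ i, 1 ≤ R i) {g : Fin n → Fin n} (hg : Set.InjOn g {i | g i ≠ i}) :
    n * (n + 2) ≤ 4 * ∑ i, min (R i) (R (g i)) := by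
  have hinj : ∀ i j, min (R i) (R (g i)) = min (R j) (R (g j)) →
      (R i ≤ R (g i) ↔ R j ≤ R (g j)) → i = j := by
    intro i j hmin hiff
    by_cases h : R i ≤ R (g i)
    · rw [min_eq_left h, min_eq_left (hiff.1 h)] at hmin
      exact hR hmin
    · have h' : ¬ R j ≤ R (g j) := fun hj => h (hiff.2 hj)
      rw [min_eq_right (not_le.1 h).le, min_eq_right (not_le.1 h').le] at hmin
      exact hg (fun e => h (by rw [e])) (fun e => h' (by rw [e])) (hR hmin)
  have hmin_pos : ∀ i, 1 ≤ min (R i) (R (g i)) := fun i => le_min (hpos i) (hpos (g i))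
  have hodd := mul_succ_le_two_mul_sum_of_injective
    (f := fun i => if R i ≤ R (g i) then 2 * min (R i) (R (g i)) - 1
      else 2 * min (R i) (R (g i)))
    (fun i j h => by
      have hi := hmin_pos i
      have hj := hmin_pos j
      dsimp only at h
      apply hinj i j <;> split_ifs at h <;> omega)
    (fun i => by
      have hi := hmin_pos i
      split_ifs <;> omega)
  have heven := mul_succ_le_two_mul_sum_of_injective
    (f := fun i => if R i ≤ R (g i) then 2 * min (R i) (R (g i))
      else 2 * min (R i) (R (g i)) - 1)
    (fun i j h => by
      have hi := hmin_pos i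
      have hj := hmin_pos j
      dsimp only at h
      apply hinj i j <;> split_ifs at h <;> omega)
    (fun i => by
      have hi := hmin_pos i
      split_ifs <;> omega)
  have hsum : ∑ i, (if R i ≤ R (g i) then 2 * min (R i) (R (g i)) - 1
      else 2 * min (R i) (R (g i))) + ∑ i, (if R i ≤ R (g i) then 2 * min (R i) (R (g i))
      else 2 * min (R i) (R (g i)) - 1) + n = 4 * ∑ i, min (R i) (R (g i)) := by
    have hn : ∑ _i : Fin n, 1 = n := by simp
    refine (congrArg (_ + ·) hn.symm).trans ?_
    rw [← sum_add_distrib, ← sum_add_distrib, mul_sum]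
    refine sum_congr rfl fun i _ => ?_
    have hi := hmin_pos i
    split_ifs <;> omega
  nlinarith

/-- For any data with pairwise distinct `X`-values and pairwise distinct
`Y`-values and any `M ∈ [n]`, the revised Chatterjee rank correlation satisfies
`ξ_{n,M} ≤ 1 - (3(M+1)/4)/(n + (M+1)/4)` and
`ξ_{n,M} ≥ -1/2 + 3·[n - (n+1)(M+1)/4]/(2(n+1)(n + (M+1)/4))`. -/
theorem xiStat_range (n M : ℕ) (hn : 1 ≤ n) (hM1 : 1 ≤ M) (hMn : M ≤ n)
    (x y : Fin n → ℝ) (hx : Function.Injective x) (hy : Function.Injective y) :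
    xiStat n M x y ≤ 1 - (3 * ((M : ℝ) + 1) / 4) / ((n : ℝ) + (M + 1) / 4) ∧
    -(1 / 2 : ℝ) + 3 * ((n : ℝ) - ((n : ℝ) + 1) * ((M : ℝ) + 1) / 4)
        / (2 * ((n : ℝ) + 1) * ((n : ℝ) + ((M : ℝ) + 1) / 4)) ≤ xiStat n M x y := by
  have hM : (0 : ℝ) < M := by exact_mod_cast hM1
  have hc : (0 : ℝ) < (n : ℝ) + ((M : ℝ) + 1) / 4 := by positivity
  have hn' : (0 : ℝ) < (n : ℝ) + 1 := by positivity
  set S : ℝ := ∑ i, ∑ m ∈ Finset.Icc 1 M,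
    (min (rankOf y i) (rankOf y (rightNN x m i)) : ℝ) with hS
  have hupper : 2 * S ≤ M * (n * (n + 1)) := by
    have hrow : S ≤ ∑ i, (M : ℝ) * rankOf y i := by
      refine sum_le_sum fun i _ => (sum_le_sum fun m _ => min_le_left _ _).trans_eq ?_
      simp
    have hr : (2 : ℝ) * ∑ i, (rankOf y i : ℝ) = n * (n + 1) := by exact_mod_cast sum_rankOf hy
    rw [← mul_sum] at hrow
    rw [← hr]
    linarith
  have hlower : M * (n * (n + 2)) ≤ 4 * S := by
    rw [hS, sum_comm, mul_sum]
    calc (M : ℝ) * (n * (n + 2)) = ∑ m ∈ Finset.Icc 1 M, (n * (n + 2) : ℝ) := by simp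
      _ ≤ _ := sum_le_sum fun m hm => by
        exact_mod_cast mul_add_two_le_four_mul_sum_min (rankOf_injective hy) (one_le_rankOf y)
          (rightNN_injOn hx (mem_Icc.1 hm).1)
  have hxi : xiStat n M x y =
      -2 + 6 * S / (M * (((n : ℝ) + 1) * ((n : ℝ) + ((M : ℝ) + 1) / 4))) := by
    rw [xiStat, ← hS]
    congr 2
    ring
  have hD : 0 < M * (((n : ℝ) + 1) * ((n : ℝ) + ((M : ℝ) + 1) / 4)) := by positivity
  rw [hxi]
  constructor
  · have hrhs : 1 - (3 * ((M : ℝ) + 1) / 4) / ((n : ℝ) + (M + 1) / 4) =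
        -2 + 3 * (M * (n * (n + 1))) / (M * (((n : ℝ) + 1) * ((n : ℝ) + ((M : ℝ) + 1) / 4))) := by
      field_simp
      ring
    rw [hrhs]
    gcongr -2 + ?_ / _
    linarith
  · have hlhs : -(1 / 2 : ℝ) + 3 * ((n : ℝ) - ((n : ℝ) + 1) * ((M : ℝ) + 1) / 4)
        / (2 * ((n : ℝ) + 1) * ((n : ℝ) + ((M : ℝ) + 1) / 4)) =
        -2 + 3 / 2 * (M * (n * (n + 2))) /
          (M * (((n : ℝ) + 1) * ((n : ℝ) + ((M : ℝ) + 1) / 4))) := by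
      field_simp
      ring
    rw [hlhs]
    gcongr -2 + ?_ / _
    linarith
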